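/- Supersymmetric factorization of the transformed linearized operator: let A ∈ C¹((0,∞),ℝ) and m ∈ ℤ. Define A_Q ψ := ψ' + ((A−m)/sinh r − coth r)ψ and A_Q* ψ := −ψ' − coth(r)ψ + ((A−m)/sinh r − coth r)ψ, and 𝓡 ψ := −ψ'' − coth(r)ψ' + ψ + (1/sinh²r − A'/sinh r + 2coth(r)(m−A)/sinh r + ((A−m)/sinh r)²)ψ. Then for every ψ ∈ C²((0,∞),ℂ) and every r > 0: A_Q*(A_Q ψ)(r) − ψ(r) = 𝓡 ψ(r). -/

import Mathlib

/- Supersymmetric factorization of the transformed linearized operator 𝓡. -/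

open Set

noncomputable section

/-- Hyperbolic cotangent. -/
def hcoth (r : ℝ) : ℝ := Real.cosh r / Real.sinh r

/-- The lowering operator `A_Q ψ = ψ' + ((A−m)/sinh r − coth r)ψ`. -/
def AQop (A : ℝ → ℝ) (m : ℤ) (ψ : ℝ → ℂ) (r : ℝ) : ℂ :=
  deriv ψ r + (((A r - m) / Real.sinh r - hcoth r : ℝ) : ℂ) * ψ r

/-- Its formal adjoint `A_Q* ψ = −ψ' − coth(r)ψ + ((A−m)/sinh r − coth r)ψ`. -/
def AQstarop (A : ℝ → ℝ) (m : ℤ) (ψ : ℝ → ℂ) (r : ℝ) : ℂ :=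
  -deriv ψ r - ((hcoth r : ℝ) : ℂ) * ψ r
    + (((A r - m) / Real.sinh r - hcoth r : ℝ) : ℂ) * ψ r

/-- The transformed linearized operator
`𝓡 ψ = −ψ'' − coth(r)ψ' + ψ + (1/sinh²r − A'/sinh r + 2coth(r)(m−A)/sinh r + ((A−m)/sinh r)²)ψ`. -/
def Rop (A : ℝ → ℝ) (m : ℤ) (ψ : ℝ → ℂ) (r : ℝ) : ℂ :=
  -deriv (deriv ψ) r - ((hcoth r : ℝ) : ℂ) * deriv ψ r + ψ r
    + ((1 / Real.sinh r ^ 2 - deriv A r / Real.sinh r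
        + 2 * hcoth r * ((m:ℝ) - A r) / Real.sinh r
        + ((A r - m) / Real.sinh r) ^ 2 : ℝ) : ℂ) * ψ r

theorem hasDerivAt_hcoth {r : ℝ} (hr : Real.sinh r ≠ 0) :
    HasDerivAt hcoth (-(1 / Real.sinh r ^ 2)) r := by
  have h := (Real.hasDerivAt_cosh r).div (Real.hasDerivAt_sinh r) hr
  refine h.congr_deriv ?_
  rw [← Real.cosh_sq_sub_sinh_sq r]
  ring

theorem hasDerivAt_superpotential {A : ℝ → ℝ} {a r : ℝ} (m : ℝ) (hA : HasDerivAt A a r)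
    (hr : Real.sinh r ≠ 0) :
    HasDerivAt (fun s => (A s - m) / Real.sinh s - hcoth s)
      (a / Real.sinh r - (A r - m) / Real.sinh r * hcoth r + 1 / Real.sinh r ^ 2) r := by
  have h := ((hA.sub_const m).div (Real.hasDerivAt_sinh r) hr).sub (hasDerivAt_hcoth hr)
  refine h.congr_deriv ?_
  unfold hcoth
  field_simp
  ring

theorem hcoth_sq {r : ℝ} (hr : Real.sinh r ≠ 0) :
    hcoth r ^ 2 = 1 + 1 / Real.sinh r ^ 2 := by
  unfold hcoth
  rw [div_pow, Real.cosh_sq]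
  field_simp

/-- **Supersymmetric factorization:** `A_Q*(A_Q ψ) − ψ = 𝓡 ψ` on `(0,∞)`. -/
theorem supersymmetric_factorization
    (A : ℝ → ℝ) (hA : ContDiffOn ℝ 1 A (Set.Ioi 0))
    (m : ℤ)
    (ψ : ℝ → ℂ) (hψ : ContDiffOn ℝ 2 ψ (Set.Ioi 0)) :
    ∀ r ∈ Set.Ioi (0:ℝ),
      AQstarop A m (fun s => AQop A m ψ s) r - ψ r = Rop A m ψ r := by
  intro r hr
  have hs : Real.sinh r ≠ 0 := (Real.sinh_pos_iff.mpr hr).ne'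
  have hnhds : Ioi (0 : ℝ) ∈ nhds r := isOpen_Ioi.mem_nhds hr
  have hA' : HasDerivAt A (deriv A r) r :=
    ((hA.contDiffAt hnhds).differentiableAt one_ne_zero).hasDerivAt
  have hψ' : HasDerivAt ψ (deriv ψ r) r :=
    ((hψ.contDiffAt hnhds).differentiableAt two_ne_zero).hasDerivAt
  have hψ'' : HasDerivAt (deriv ψ) (deriv (deriv ψ) r) r :=
    (((hψ.deriv_of_isOpen isOpen_Ioi (m := 1) (by norm_num)).contDiffAt hnhds).differentiableAt
      one_ne_zero).hasDerivAt
  have hAQ : deriv (fun s => AQop A m ψ s) r = _ :=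
    (hψ''.add ((hasDerivAt_superpotential m hA' hs).ofReal_comp.mul hψ')).deriv
  have hc : ((hcoth r : ℝ) : ℂ) ^ 2 = 1 + 1 / (Real.sinh r : ℂ) ^ 2 := by
    exact_mod_cast hcoth_sq hs
  unfold AQstarop
  rw [hAQ]
  unfold AQop Rop
  push_cast at hc ⊢
  linear_combination 2 * ψ r * hc

end
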